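/- Let 𝒟 be a strongly first order, relativizable family of generalized dependencies. Then every sentence of FO(𝒟, const) is equivalent to some first-order sentence, and every sentence of FO(𝒟^(P), const) is also equivalent to some first-order sentence. -/

import Mathlib

namespace DSFO

/-- A purely relational signature: for each arity, a type of relation symbols. -/
abbrev Signature := ℕ → Type

/-- The empty signature. -/
def Sig0 : Signature := fun _ => Empty

/-- The signature with a single `k`-ary relation symbol `R`. -/
def SigR (k : ℕ) : Signature := fun n => PLift (n = k)

/-- Syntax of team-semantics formulas (in negation normal form, with the two
additional connectives: global disjunction `gdisj` and contradictory negation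
`cneg`) over a relational signature `S`, with generalized dependency atoms
indexed by `ι` with arities `ar`.  Variables are natural numbers. -/
inductive TS (S : Signature) (ι : Type) (ar : ι → ℕ) : Type
  | rel {k : ℕ} (r : S k) (v : Fin k → ℕ)
  | nrel {k : ℕ} (r : S k) (v : Fin k → ℕ)
  | eq (x y : ℕ)
  | neq (x y : ℕ)
  | dep (i : ι) (v : Fin (ar i) → ℕ)
  | and (φ ψ : TS S ι ar)
  | or (φ ψ : TS S ι ar)
  | gdisj (φ ψ : TS S ι ar)
  | cneg (φ : TS S ι ar)
  | ex (v : ℕ) (φ : TS S ι ar)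
  | al (v : ℕ) (φ : TS S ι ar)

/-- The always-true literal `⊤`. -/
def TS.top {S : Signature} {ι : Type} {ar : ι → ℕ} : TS S ι ar := .eq 0 0

/-- The arity function for "no dependency atoms". -/
def noAtoms : Empty → ℕ := fun e => e.elim

/-- First-order formulas over `S` (no dependency atoms; here `cneg` plays the
role of ordinary classical negation and `gdisj` of ordinary disjunction, so
this is full first-order logic). -/
abbrev FOF (S : Signature) := TS S Empty noAtoms

/-- First-order formulas over the empty signature. -/
abbrev EF := FOF Sig0

/-- Free variables of a formula. -/
def fv {S : Signature} {ι : Type} {ar : ι → ℕ} : TS S ι ar → Set ℕ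
  | .rel _ v => Set.range v
  | .nrel _ v => Set.range v
  | .eq x y => {x, y}
  | .neq x y => {x, y}
  | .dep _ v => Set.range v
  | .and φ ψ => fv φ ∪ fv ψ
  | .or φ ψ => fv φ ∪ fv ψ
  | .gdisj φ ψ => fv φ ∪ fv ψ
  | .cneg φ => fv φ
  | .ex v φ => fv φ \ {v}
  | .al v φ => fv φ \ {v}

/-- A sentence is a formula with no free variables. -/
def IsSentence {S : Signature} {ι : Type} {ar : ι → ℕ} (φ : TS S ι ar) : Prop :=
  fv φ = ∅

/-- No global disjunctions occur. -/
def NoGdisj {S : Signature} {ι : Type} {ar : ι → ℕ} : TS S ι ar → Prop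
  | .rel _ _ => True
  | .nrel _ _ => True
  | .eq _ _ => True
  | .neq _ _ => True
  | .dep _ _ => True
  | .and φ ψ => NoGdisj φ ∧ NoGdisj ψ
  | .or φ ψ => NoGdisj φ ∧ NoGdisj ψ
  | .gdisj _ _ => False
  | .cneg φ => NoGdisj φ
  | .ex _ φ => NoGdisj φ
  | .al _ φ => NoGdisj φ

/-- No contradictory negations occur. -/
def NoCneg {S : Signature} {ι : Type} {ar : ι → ℕ} : TS S ι ar → Prop
  | .rel _ _ => True
  | .nrel _ _ => True
  | .eq _ _ => True
  | .neq _ _ => True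
  | .dep _ _ => True
  | .and φ ψ => NoCneg φ ∧ NoCneg ψ
  | .or φ ψ => NoCneg φ ∧ NoCneg ψ
  | .gdisj φ ψ => NoCneg φ ∧ NoCneg ψ
  | .cneg _ => False
  | .ex _ φ => NoCneg φ
  | .al _ φ => NoCneg φ

/-- Formulas of `FO(𝒟)` proper: no `gdisj` and no `cneg`. -/
def Plain {S : Signature} {ι : Type} {ar : ι → ℕ} (φ : TS S ι ar) : Prop :=
  NoCneg φ ∧ NoGdisj φ

/-- Atomic formulas: first-order literals and dependency atoms. -/
def Atomic {S : Signature} {ι : Type} {ar : ι → ℕ} : TS S ι ar → Prop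
  | .rel _ _ => True
  | .nrel _ _ => True
  | .eq _ _ => True
  | .neq _ _ => True
  | .dep _ _ => True
  | _ => False

/-- Formulas of `FO(∼₀, 𝒟)`: the contradictory negation may appear only in
front of first-order literals and dependency atoms (and there is no `gdisj`). -/
def Cneg0 {S : Signature} {ι : Type} {ar : ι → ℕ} : TS S ι ar → Prop
  | .rel _ _ => True
  | .nrel _ _ => True
  | .eq _ _ => True
  | .neq _ _ => True
  | .dep _ _ => True
  | .and φ ψ => Cneg0 φ ∧ Cneg0 ψ
  | .or φ ψ => Cneg0 φ ∧ Cneg0 ψ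
  | .gdisj _ _ => False
  | .cneg φ => Atomic φ
  | .ex _ φ => Cneg0 φ
  | .al _ φ => Cneg0 φ

/-- The negation normal form of the (dual) negation of a formula. -/
def TS.nneg {S : Signature} {ι : Type} {ar : ι → ℕ} : TS S ι ar → TS S ι ar
  | .rel r v => .nrel r v
  | .nrel r v => .rel r v
  | .eq x y => .neq x y
  | .neq x y => .eq x y
  | .dep i v => .cneg (.dep i v)
  | .and φ ψ => .or (TS.nneg φ) (TS.nneg ψ)
  | .or φ ψ => .and (TS.nneg φ) (TS.nneg ψ)
  | .gdisj φ ψ => .and (TS.nneg φ) (TS.nneg ψ)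
  | .cneg φ => φ
  | .ex v φ => .al v (TS.nneg φ)
  | .al v φ => .ex v (TS.nneg φ)

/-- Iterated existential quantification over a list of variables. -/
def exs {S : Signature} {ι : Type} {ar : ι → ℕ} (l : List ℕ) (φ : TS S ι ar) :
    TS S ι ar := l.foldr TS.ex φ

/-- An interpretation of a relational signature in a domain `M`. -/
abbrev Interp (S : Signature) (M : Type) := ∀ k, S k → Set (Fin k → M)

/-- The unique interpretation of the empty signature. -/
def eI (M : Type) : Interp Sig0 M := fun _ e => e.elim

/-- The interpretation of `SigR k` given by a `k`-ary relation `R`. -/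
def interpR {k : ℕ} {M : Type} (R : Set (Fin k → M)) : Interp (SigR k) M :=
  fun _ r => {s | (fun i => s (Fin.cast r.down.symm i)) ∈ R}

/-- Tarskian (single-assignment) satisfaction.  Dependency atoms are
(vacuously) interpreted as true; this is only used on first-order formulas. -/
def FSat {S : Signature} {ι : Type} {ar : ι → ℕ} (M : Type) (I : Interp S M) :
    (ℕ → M) → TS S ι ar → Prop
  | s, .rel r v => (fun i => s (v i)) ∈ I _ r
  | s, .nrel r v => (fun i => s (v i)) ∉ I _ r
  | s, .eq x y => s x = s y
  | s, .neq x y => s x ≠ s y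
  | _, .dep _ _ => True
  | s, .and φ ψ => FSat M I s φ ∧ FSat M I s ψ
  | s, .or φ ψ => FSat M I s φ ∨ FSat M I s ψ
  | s, .gdisj φ ψ => FSat M I s φ ∨ FSat M I s ψ
  | s, .cneg φ => ¬ FSat M I s φ
  | s, .ex v φ => ∃ m : M, FSat M I (Function.update s v m) φ
  | s, .al v φ => ∀ m : M, FSat M I (Function.update s v m) φ

/-- Truth of a first-order sentence (Tarskian semantics). -/
def FOTrue {S : Signature} {ι : Type} {ar : ι → ℕ} (M : Type) (I : Interp S M)
    (φ : TS S ι ar) : Prop :=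
  ∀ s : ℕ → M, FSat M I s φ

/-- The relation `X(x̄)` determined by a team `X` and a tuple of variables `x̄`. -/
def teamProj {M : Type} {k : ℕ} (v : Fin k → ℕ) (X : Set (ℕ → M)) :
    Set (Fin k → M) := {t | ∃ s ∈ X, t = fun j => s (v j)}

/-- (Lax) team semantics.  `A` gives the semantics of each dependency atom as a
function of the relation `X(x̄)`. -/
def TSat {S : Signature} {ι : Type} {ar : ι → ℕ} (M : Type) (I : Interp S M)
    (A : ∀ i, Set (Fin (ar i) → M) → Prop) :
    TS S ι ar → Set (ℕ → M) → Prop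
  | .rel r v, X => ∀ s ∈ X, (fun i => s (v i)) ∈ I _ r
  | .nrel r v, X => ∀ s ∈ X, (fun i => s (v i)) ∉ I _ r
  | .eq x y, X => ∀ s ∈ X, s x = s y
  | .neq x y, X => ∀ s ∈ X, s x ≠ s y
  | .dep i v, X => A i (teamProj v X)
  | .and φ ψ, X => TSat M I A φ X ∧ TSat M I A ψ X
  | .or φ ψ, X => ∃ Y Z : Set (ℕ → M), Y ∪ Z = X ∧ TSat M I A φ Y ∧ TSat M I A ψ Z
  | .gdisj φ ψ, X => TSat M I A φ X ∨ TSat M I A ψ X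
  | .cneg φ, X => ¬ TSat M I A φ X
  | .ex v φ, X => ∃ H : (ℕ → M) → Set M, (∀ s ∈ X, (H s).Nonempty) ∧
      TSat M I A φ {s' | ∃ s ∈ X, ∃ m ∈ H s, s' = Function.update s v m}
  | .al v φ, X => TSat M I A φ {s' | ∃ s ∈ X, ∃ m : M, s' = Function.update s v m}

/-- Truth of a sentence under team semantics: satisfaction by the team of all
assignments (by locality, equivalent to satisfaction by `{∅}`). -/
def TTrue {S : Signature} {ι : Type} {ar : ι → ℕ} (M : Type) (I : Interp S M)
    (A : ∀ i, Set (Fin (ar i) → M) → Prop) (φ : TS S ι ar) : Prop :=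
  TSat M I A φ Set.univ

/-- A `k`-ary dependency predicate: a class of pairs `(M, R)`. -/
abbrev DepPred (k : ℕ) := ∀ M : Type, Set (Fin k → M) → Prop

/-- Closure under isomorphisms (part of the definition of a generalized
dependency). -/
def IsoClosed {k : ℕ} (D : DepPred k) : Prop :=
  ∀ (M N : Type) (e : M ≃ N) (R : Set (Fin k → M)),
    D M R → D N ((fun f => e ∘ f) '' R)

/-- The complement `∼D` of a dependency. -/
def complD {k : ℕ} (D : DepPred k) : DepPred k := fun M R => ¬ D M R

def DownwardsClosed {k : ℕ} (D : DepPred k) : Prop :=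
  ∀ (M : Type) (R R' : Set (Fin k → M)), D M R → R' ⊆ R → D M R'

/-- The downwards closure `D↓`. -/
def dClosure {k : ℕ} (D : DepPred k) : DepPred k :=
  fun M R => ∃ R', R ⊆ R' ∧ D M R'

/-- `D_max`: the maximal models of `D`. -/
def DMax {k : ℕ} (D : DepPred k) : DepPred k :=
  fun M R => D M R ∧ ∀ R', R ⊂ R' → ¬ D M R'

/-- The empty team property. -/
def EmptyTeamProp {k : ℕ} (D : DepPred k) : Prop :=
  ∀ M : Type, Nontrivial M → D M (∅ : Set (Fin k → M))

/-- `D` is a first-order dependency: it is the class of models of a first-order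
sentence over the signature `{R}`. -/
def FirstOrderDep {k : ℕ} (D : DepPred k) : Prop :=
  ∃ ψ : FOF (SigR k), IsSentence ψ ∧
    ∀ (M : Type), Nontrivial M → ∀ R : Set (Fin k → M),
      (D M R ↔ FOTrue M (interpR R) ψ)

/-- The interpretation of a unary predicate symbol as a subset of the domain. -/
def PSet {S : Signature} {M : Type} (I : Interp S M) (P : S 1) : Set M :=
  {m | (fun _ => m) ∈ I 1 P}

/-- Semantics of the relativization `D^(P)` of `D` to the unary predicate `P`:
`𝔐 ⊨_X D^(P) x̄` iff `(P^𝔐, X(x̄)) ∈ D`. -/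
def relSem {k : ℕ} (D : DepPred k) {S : Signature} (P : S 1)
    (M : Type) (I : Interp S M) (R : Set (Fin k → M)) : Prop :=
  (∀ f ∈ R, ∀ j, f j ∈ PSet I P) ∧
    D (↥(PSet I P)) {g : Fin k → ↥(PSet I P) | (fun j => (g j : M)) ∈ R}

/-- A family `𝒟` of generalized dependencies is strongly first order: every
sentence of `FO(𝒟)` is equivalent to some first-order sentence. -/
def SFOFam {ι : Type} {ar : ι → ℕ} (D : ∀ i, DepPred (ar i)) : Prop :=
  ∀ (S : Signature) (φ : TS S ι ar), IsSentence φ → Plain φ →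
    ∃ ψ : FOF S, IsSentence ψ ∧
      ∀ (M : Type), Nontrivial M → ∀ I : Interp S M,
        (TTrue M I (fun i => D i M) φ ↔ FOTrue M I ψ)

/-- A single dependency is strongly first order iff `{D}` is. -/
def SFOd {k : ℕ} (D : DepPred k) : Prop :=
  SFOFam (ι := Unit) (ar := fun _ => k) (fun _ => D)

/-- A family `𝒟` is relativizable: every sentence of `FO(𝒟^(P))` is equivalent
to some sentence of `FO(𝒟)`. -/
def RelativizableFam {ι : Type} {ar : ι → ℕ} (D : ∀ i, DepPred (ar i)) : Prop :=
  ∀ (S : Signature) (P : S 1) (φ : TS S ι ar), IsSentence φ → Plain φ →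
    ∃ ψ : TS S ι ar, IsSentence ψ ∧ Plain ψ ∧
      ∀ (M : Type), Nontrivial M → ∀ I : Interp S M,
        (TTrue M I (fun i => relSem (D i) P M I) φ ↔ TTrue M I (fun i => D i M) ψ)

def Relativizable1 {k : ℕ} (D : DepPred k) : Prop :=
  RelativizableFam (ι := Unit) (ar := fun _ => k) (fun _ => D)

/-- The family `𝒟 ∪ ∼𝒟`. -/
def withComplFam {ι : Type} {ar : ι → ℕ} (D : ∀ i, DepPred (ar i)) :
    ∀ i : ι ⊕ ι, DepPred (Sum.elim ar ar i) :=
  fun i => match i with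
    | .inl a => D a
    | .inr a => complD (D a)

/-- `D` is doubly strongly first order: `{D, ∼D}` is strongly first order. -/
def DSFOd {k : ℕ} (D : DepPred k) : Prop :=
  SFOFam (ι := Bool) (ar := fun _ => k)
    (fun b => match b with | true => D | false => complD D)

/-- The constancy atom of arity `k`. -/
def constD (k : ℕ) : DepPred k := fun _ R => ∀ f ∈ R, ∀ g ∈ R, f = g

/-- The totality atom of arity `k`. -/
def allD (k : ℕ) : DepPred k := fun M R => R = (Set.univ : Set (Fin k → M))

/-- The family `𝒟 ∪ {const}` (constancy atoms of every arity). -/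
def withConst {ι : Type} {ar : ι → ℕ} (D : ∀ i, DepPred (ar i)) :
    ∀ i : ι ⊕ ℕ, DepPred (Sum.elim ar id i) :=
  fun i => match i with
    | .inl a => D a
    | .inr n => constD n

/-- The atoms of `𝒟^(P) ∪ {const}`. -/
def withConstRel {ι : Type} {ar : ι → ℕ} (D : ∀ i, DepPred (ar i))
    {S : Signature} (P : S 1) (M : Type) (I : Interp S M) :
    ∀ i : ι ⊕ ℕ, Set (Fin (Sum.elim ar id i) → M) → Prop :=
  fun i => match i with
    | .inl a => relSem (D a) P M I
    | .inr n => constD n M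

/-- Atom indices of the logic `FO(𝒟₀, ⊔, const, All)`: the 0-ary first-order
dependencies `[ψ]`, the constancy atoms and the totality atoms. -/
inductive CIdx : Type
  | d0 (ψ : EF) (hψ : IsSentence ψ)
  | const (k : ℕ)
  | total (k : ℕ)

def cAr : CIdx → ℕ
  | .d0 _ _ => 0
  | .const k => k
  | .total k => k

def cSem (M : Type) : ∀ i : CIdx, Set (Fin (cAr i) → M) → Prop
  | .d0 ψ _, _ => FOTrue M (eI M) ψ
  | .const _, R => ∀ f ∈ R, ∀ g ∈ R, f = g
  | .total _, R => R = Set.univ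

/-- Embedding of first-order formulas over the empty signature into any
team logic. -/
def embedEF {S : Signature} {ι : Type} {ar : ι → ℕ} : EF → TS S ι ar
  | .rel r _ => Empty.elim r
  | .nrel r _ => Empty.elim r
  | .eq x y => .eq x y
  | .neq x y => .neq x y
  | .dep i _ => Empty.elim i
  | .and φ ψ => .and (embedEF φ) (embedEF ψ)
  | .or φ ψ => .or (embedEF φ) (embedEF ψ)
  | .gdisj φ ψ => .gdisj (embedEF φ) (embedEF ψ)
  | .cneg φ => .cneg (embedEF φ)
  | .ex v φ => .ex v (embedEF φ)
  | .al v φ => .al v (embedEF φ)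

/-- Override the values of the variables `0, …, k-1` by the tuple `f`. -/
def overrideFin {M : Type} (k : ℕ) (f : Fin k → M) (s : ℕ → M) : ℕ → M :=
  fun v => if h : v < k then f ⟨v, h⟩ else s v

/-- `(M, R) ⊨ ∃ȳ ∀x̄ (R x̄ → θ(x̄, ȳ))`, where `x̄` is the tuple of variables
`0, …, k-1` and the remaining free variables `ȳ` of `θ` are witnessed by `s`. -/
def ExAllSem {k : ℕ} (M : Type) (R : Set (Fin k → M)) (θ : EF) : Prop :=
  ∃ s : ℕ → M, ∀ f ∈ R, FSat M (eI M) (overrideFin k f s) θ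

/-- `(M, R) ⊨ ∃ȳ ∀x̄ (R x̄ ↔ θ(x̄, ȳ))`. -/
def ExAllIffSem {k : ℕ} (M : Type) (R : Set (Fin k → M)) (θ : EF) : Prop :=
  ∃ s : ℕ → M, ∀ f : Fin k → M, (f ∈ R ↔ FSat M (eI M) (overrideFin k f s) θ)

/-- The assignment sending `x̄ = (0, …, k-1)` to `f`, `ȳ = (k, …, k+n-1)` to
`a`, and every other variable to its value under `s0`. -/
def tupAsg {M : Type} (k n : ℕ) (f : Fin k → M) (a : Fin n → M) (s0 : ℕ → M) :
    ℕ → M :=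
  fun v => if h : v < k then f ⟨v, h⟩ else if h2 : v - k < n then a ⟨v - k, h2⟩ else s0 v

/-- `R` is defined by the formula `θ(x̄, ȳ)` (with `x̄ = (0, …, k-1)` and
`ȳ = (k, …, k+n-1)`): there is a tuple `ā` of parameters such that
`R = {m̄ : 𝔐 ⊨ θ(m̄, ā)}`. -/
def DefinedBy {S : Signature} {M : Type} (I : Interp S M) (k n : ℕ)
    (θ : FOF S) (R : Set (Fin k → M)) : Prop :=
  ∃ a : Fin n → M, ∀ s0 : ℕ → M, R = {f | FSat M I (tupAsg k n f a s0) θ}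

/-- `θ(x̄, ȳ)` fixes the identity type of `ȳ = (k, …, k+n-1)`. -/
def FixesIdType {S : Signature} (k n : ℕ) (θ : FOF S) : Prop :=
  ∀ i j : Fin n,
    (∀ (M : Type), Nontrivial M → ∀ (I : Interp S M) (s : ℕ → M),
        FSat M I s θ → s (k + (i : ℕ)) = s (k + (j : ℕ))) ∨
    (∀ (M : Type), Nontrivial M → ∀ (I : Interp S M) (s : ℕ → M),
        FSat M I s θ → s (k + (i : ℕ)) ≠ s (k + (j : ℕ)))

/-- `(M, R := Xv) ⊨ ∃ȳ ∀x̄ (R x̄ → θ(x̄, ȳ))` where the `x̄`-slots of `θ` are the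
variables `v̄` and the `ȳ`-slots are the variables `ȳ`. -/
def projExAll {M : Type} {k n : ℕ} (v : Fin k → ℕ) (y : Fin n → ℕ) (θ : EF)
    (Xv : Set (Fin k → M)) : Prop :=
  ∃ b : Fin n → M, ∀ f ∈ Xv, ∀ s : ℕ → M,
    (∀ j, s (v j) = f j) → (∀ i, s (y i) = b i) → FSat M (eI M) s θ


section ConstElimination

variable {S : Signature} {ι : Type} {ar : ι → ℕ} {M : Type}

theorem FSat_congr (I : Interp S M) (φ : TS S ι ar) {s t : ℕ → M}
    (h : ∀ v ∈ fv φ, s v = t v) : FSat M I s φ ↔ FSat M I t φ := by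
  induction φ generalizing s t with
  | rel r v =>
    have : (fun i => s (v i)) = fun i => t (v i) := funext fun i => h _ ⟨i, rfl⟩
    simp only [FSat, this]
  | nrel r v =>
    have : (fun i => s (v i)) = fun i => t (v i) := funext fun i => h _ ⟨i, rfl⟩
    simp only [FSat, this]
  | eq x y => simp only [FSat, h x (by simp [fv]), h y (by simp [fv])]
  | neq x y => simp only [FSat, h x (by simp [fv]), h y (by simp [fv])]
  | dep i v => rfl
  | and φ ψ ih₁ ih₂ =>
    exact and_congr (ih₁ fun v hv => h v (.inl hv)) (ih₂ fun v hv => h v (.inr hv))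
  | or φ ψ ih₁ ih₂ =>
    exact or_congr (ih₁ fun v hv => h v (.inl hv)) (ih₂ fun v hv => h v (.inr hv))
  | gdisj φ ψ ih₁ ih₂ =>
    exact or_congr (ih₁ fun v hv => h v (.inl hv)) (ih₂ fun v hv => h v (.inr hv))
  | cneg φ ih => exact not_congr (ih h)
  | ex x φ ih =>
    refine exists_congr fun m => ih fun v hv => ?_
    by_cases hvx : v = x
    · simp [hvx]
    · simpa [hvx] using h v ⟨hv, hvx⟩
  | al x φ ih =>
    refine forall_congr' fun m => ih fun v hv => ?_
    by_cases hvx : v = x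
    · simp [hvx]
    · simpa [hvx] using h v ⟨hv, hvx⟩

theorem FOTrue_iff_FSat (I : Interp S M) {φ : TS S ι ar} (h : IsSentence φ) (s : ℕ → M) :
    FOTrue M I φ ↔ FSat M I s φ :=
  ⟨fun H => H s, fun H _ => (FSat_congr I φ fun _ hv => (h.subset hv).elim).1 H⟩

theorem finite_fv (φ : TS S ι ar) : (fv φ).Finite := by
  induction φ with
  | rel r v => exact Set.finite_range v
  | nrel r v => exact Set.finite_range v
  | eq x y => exact Set.toFinite {x, y}
  | neq x y => exact Set.toFinite {x, y}
  | dep i v => exact Set.finite_range v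
  | and φ ψ ih₁ ih₂ => exact ih₁.union ih₂
  | or φ ψ ih₁ ih₂ => exact ih₁.union ih₂
  | gdisj φ ψ ih₁ ih₂ => exact ih₁.union ih₂
  | cneg φ ih => exact ih
  | ex x φ ih => exact ih.sdiff
  | al x φ ih => exact ih.sdiff

theorem fv_exs (l : List ℕ) (φ : TS S ι ar) : fv (exs l φ) = fv φ \ {v | v ∈ l} := by
  induction l with
  | nil => simp [exs]
  | cons a l ih =>
    change fv (exs l φ) \ {a} = _
    rw [ih]
    ext v
    simp only [Set.mem_sdiff, Set.mem_ofPred_eq, Set.mem_singleton_iff, List.mem_cons]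
    tauto

theorem FSat_exs (I : Interp S M) (l : List ℕ) (φ : TS S ι ar) (s : ℕ → M) :
    FSat M I s (exs l φ) ↔ ∃ t : ℕ → M, (∀ v, v ∉ l → t v = s v) ∧ FSat M I t φ := by
  induction l generalizing s with
  | nil =>
    refine ⟨fun h => ⟨s, fun _ _ => rfl, h⟩, fun ⟨t, ht, h⟩ => ?_⟩
    rwa [← show t = s from funext fun v => ht v (by simp)]
  | cons a l ih =>
    change (∃ m, FSat M I (Function.update s a m) (exs l φ)) ↔ _
    simp only [ih]
    constructor
    · rintro ⟨m, t, ht, h⟩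
      refine ⟨t, fun v hv => ?_, h⟩
      simp only [List.mem_cons, not_or] at hv
      rw [ht v hv.2, Function.update_of_ne hv.1]
    · rintro ⟨t, ht, h⟩
      refine ⟨t a, t, fun v hv => ?_, h⟩
      by_cases hva : v = a
      · simp [hva]
      · rw [Function.update_of_ne hva, ht v (by simp [hva, hv])]

/-- The existential closure of a formula. -/
theorem exists_sentence_iff_exists_FSat (φ : TS S ι ar) :
    ∃ ψ : TS S ι ar, IsSentence ψ ∧ ∀ (M : Type), Nonempty M → ∀ I : Interp S M,
      (FOTrue M I ψ ↔ ∃ s, FSat M I s φ) := by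
  have hl : ∀ v, v ∈ (finite_fv φ).toFinset.toList ↔ v ∈ fv φ := by simp
  have hs : IsSentence (exs (finite_fv φ).toFinset.toList φ) := by
    rw [IsSentence, fv_exs]
    ext v
    simp [hl]
  refine ⟨_, hs, fun M ⟨m⟩ I => ?_⟩
  rw [FOTrue_iff_FSat I hs fun _ => m, FSat_exs]
  refine ⟨fun ⟨t, _, h⟩ => ⟨t, h⟩, fun ⟨t, h⟩ => ?_⟩
  classical
  refine ⟨fun v => if v ∈ fv φ then t v else m, fun v hv => if_neg (by rwa [← hl]), ?_⟩
  exact (FSat_congr I φ fun v hv => by simp [hv]).1 h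

/-- The signature `S` with countably many new relation symbols in each arity. -/
def tupleSig (S : Signature) : Signature := fun k => S k ⊕ ℕ

/-- The expansion of `I` in which the new `k`-ary symbol `n` denotes the singleton of the tuple
whose `j`-th entry is `J (Nat.pair n j)`. -/
def tupleInterp (I : Interp S M) (J : ℕ → M) : Interp (tupleSig S) M := fun k r =>
  match r with
  | .inl r => I k r
  | .inr n => {fun j : Fin k => J (Nat.pair n j)}

/-- The number of occurrences of constancy atoms. -/
def constCount : TS S (ι ⊕ ℕ) (Sum.elim ar id) → ℕ
  | .dep (.inr _) _ => 1
  | .and φ ψ | .or φ ψ | .gdisj φ ψ => constCount φ + constCount ψ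
  | .cneg φ | .ex _ φ | .al _ φ => constCount φ
  | _ => 0

/-- Replace the constancy atoms, from left to right, by the new relation symbols
`n, n + 1, …`. -/
def elimConst : TS S (ι ⊕ ℕ) (Sum.elim ar id) → ℕ → TS (tupleSig S) ι ar
  | .rel r v, _ => .rel (Sum.inl r : tupleSig S _) v
  | .nrel r v, _ => .nrel (Sum.inl r : tupleSig S _) v
  | .eq x y, _ => .eq x y
  | .neq x y, _ => .neq x y
  | .dep (.inl i) v, _ => .dep i v
  | .dep (.inr k) v, n => .rel (k := k) (Sum.inr n : tupleSig S k) v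
  | .and φ ψ, n => .and (elimConst φ n) (elimConst ψ (n + constCount φ))
  | .or φ ψ, n => .or (elimConst φ n) (elimConst ψ (n + constCount φ))
  | .gdisj φ ψ, n => .gdisj (elimConst φ n) (elimConst ψ (n + constCount φ))
  | .cneg φ, n => .cneg (elimConst φ n)
  | .ex x φ, n => .ex x (elimConst φ n)
  | .al x φ, n => .al x (elimConst φ n)

theorem fv_elimConst (φ : TS S (ι ⊕ ℕ) (Sum.elim ar id)) (n : ℕ) :
    fv (elimConst φ n) = fv φ := by
  induction φ generalizing n with
  | dep i v => cases i <;> rfl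
  | _ => simp_all [elimConst, fv]

theorem plain_elimConst {φ : TS S (ι ⊕ ℕ) (Sum.elim ar id)} (h : Plain φ) (n : ℕ) :
    Plain (elimConst φ n) := by
  induction φ generalizing n with
  | dep i v => cases i <;> exact ⟨trivial, trivial⟩
  | _ => simp_all [elimConst, Plain, NoCneg, NoGdisj]

theorem TSat_elimConst_congr (I : Interp S M) (A : ∀ i, Set (Fin (ar i) → M) → Prop)
    {J J' : ℕ → M} (φ : TS S (ι ⊕ ℕ) (Sum.elim ar id)) (n : ℕ)
    (h : ∀ a b, n ≤ a → a < n + constCount φ → J (Nat.pair a b) = J' (Nat.pair a b))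
    (X : Set (ℕ → M)) :
    TSat M (tupleInterp I J) A (elimConst φ n) X ↔
      TSat M (tupleInterp I J') A (elimConst φ n) X := by
  induction φ generalizing n X with
  | rel r v => rfl
  | nrel r v => rfl
  | eq x y => rfl
  | neq x y => rfl
  | dep i v =>
    cases i with
    | inl i => rfl
    | inr k =>
      have : (fun j : Fin k => J (Nat.pair n j)) = fun j : Fin k => J' (Nat.pair n j) :=
        funext fun j => h _ _ le_rfl (by simp [constCount])
      simp only [elimConst, TSat, tupleInterp, this]
  | and φ ψ ih₁ ih₂ =>
    simp only [constCount] at h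
    exact and_congr (ih₁ n (fun a b h₁ h₂ => h a b h₁ (by omega)) X)
      (ih₂ _ (fun a b h₁ h₂ => h a b (by omega) (by omega)) X)
  | or φ ψ ih₁ ih₂ =>
    simp only [constCount] at h
    exact exists_congr fun Y => exists_congr fun Z => and_congr_right fun _ =>
      and_congr (ih₁ n (fun a b h₁ h₂ => h a b h₁ (by omega)) Y)
        (ih₂ _ (fun a b h₁ h₂ => h a b (by omega) (by omega)) Z)
  | gdisj φ ψ ih₁ ih₂ =>
    simp only [constCount] at h
    exact or_congr (ih₁ n (fun a b h₁ h₂ => h a b h₁ (by omega)) X)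
      (ih₂ _ (fun a b h₁ h₂ => h a b (by omega) (by omega)) X)
  | cneg φ ih =>
    exact not_congr (ih n h X)
  | ex x φ ih =>
    exact exists_congr fun H => and_congr_right fun _ => ih n h _
  | al x φ ih =>
    exact ih n h _

theorem exists_TSat_elimConst_and (I : Interp S M) (A : ∀ i, Set (Fin (ar i) → M) → Prop)
    (φ ψ : TS S (ι ⊕ ℕ) (Sum.elim ar id)) (n : ℕ) (X Y : Set (ℕ → M)) :
    (∃ J, TSat M (tupleInterp I J) A (elimConst φ n) X ∧
      TSat M (tupleInterp I J) A (elimConst ψ (n + constCount φ)) Y) ↔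
    (∃ J, TSat M (tupleInterp I J) A (elimConst φ n) X) ∧
      ∃ J, TSat M (tupleInterp I J) A (elimConst ψ (n + constCount φ)) Y := by
  refine ⟨fun ⟨J, h₁, h₂⟩ => ⟨⟨J, h₁⟩, ⟨J, h₂⟩⟩, fun ⟨⟨J₁, h₁⟩, ⟨J₂, h₂⟩⟩ => ?_⟩
  refine ⟨fun m => if m.unpair.1 < n + constCount φ then J₁ m else J₂ m, ?_, ?_⟩
  · refine (TSat_elimConst_congr I A φ n (fun a b _ h => ?_) X).1 h₁
    simp [h]
  · refine (TSat_elimConst_congr I A ψ _ (fun a b h _ => ?_) Y).1 h₂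
    simp [h]

theorem TSat_iff_exists_TSat_elimConst [Nonempty M] (I : Interp S M)
    (A : ∀ i, Set (Fin (ar i) → M) → Prop)
    (B : ∀ i : ι ⊕ ℕ, Set (Fin (Sum.elim ar id i) → M) → Prop)
    (hA : ∀ i R, B (.inl i) R ↔ A i R) (hconst : ∀ k R, B (.inr k) R ↔ constD k M R)
    {φ : TS S (ι ⊕ ℕ) (Sum.elim ar id)} (hφ : Plain φ) (n : ℕ) (X : Set (ℕ → M)) :
    TSat M I B φ X ↔ ∃ J, TSat M (tupleInterp I J) A (elimConst φ n) X := by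
  induction φ generalizing n X with
  | rel r v => exact exists_const _ |>.symm
  | nrel r v => exact exists_const _ |>.symm
  | eq x y => exact exists_const _ |>.symm
  | neq x y => exact exists_const _ |>.symm
  | dep i v =>
    cases i with
    | inl i => exact (hA i _).trans (exists_const _).symm
    | inr k =>
      refine (hconst k _).trans ?_
      change (∀ f ∈ teamProj v X, ∀ g ∈ teamProj v X, f = g) ↔
        ∃ J : ℕ → M, ∀ s ∈ X, (fun i : Fin k => s (v i)) = fun j : Fin k => J (Nat.pair n j)
      constructor
      · intro h
        obtain rfl | ⟨s, hs⟩ := X.eq_empty_or_nonempty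
        · exact ⟨fun _ => Classical.arbitrary M, by simp⟩
        · refine ⟨fun m => if hm : m.unpair.2 < k then s (v ⟨m.unpair.2, hm⟩)
            else Classical.arbitrary M, fun t ht => ?_⟩
          have := h _ ⟨t, ht, rfl⟩ _ ⟨s, hs, rfl⟩
          exact this.trans (funext fun j : Fin k => by simp)
      · rintro ⟨J, hJ⟩ _ ⟨s, hs, rfl⟩ _ ⟨t, ht, rfl⟩
        exact (hJ s hs).trans (hJ t ht).symm
  | and φ ψ ih₁ ih₂ =>
    exact (and_congr (ih₁ ⟨hφ.1.1, hφ.2.1⟩ n X) (ih₂ ⟨hφ.1.2, hφ.2.2⟩ _ X)).trans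
      (exists_TSat_elimConst_and I A φ ψ n X X).symm
  | or φ ψ ih₁ ih₂ =>
    simp only [TSat, elimConst, ih₁ ⟨hφ.1.1, hφ.2.1⟩ n, ih₂ ⟨hφ.1.2, hφ.2.2⟩ (n + constCount φ),
      ← exists_TSat_elimConst_and]
    exact ⟨fun ⟨Y, Z, h, J, hJ⟩ => ⟨J, Y, Z, h, hJ⟩, fun ⟨J, Y, Z, h, hJ⟩ => ⟨Y, Z, h, J, hJ⟩⟩
  | gdisj φ ψ => exact hφ.2.elim
  | cneg φ => exact hφ.1.elim
  | ex x φ ih =>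
    simp only [TSat, elimConst, ih hφ n]
    exact ⟨fun ⟨H, h, J, hJ⟩ => ⟨J, H, h, hJ⟩, fun ⟨J, H, h, hJ⟩ => ⟨H, h, J, hJ⟩⟩
  | al x φ ih => exact ih hφ n _

/-- A strict upper bound on all variables, free or bound, of a formula. -/
def varBound : TS S ι ar → ℕ
  | .rel _ v => Finset.univ.sup v + 1
  | .nrel _ v => Finset.univ.sup v + 1
  | .eq x y => max x y + 1
  | .neq x y => max x y + 1
  | .dep _ v => Finset.univ.sup v + 1
  | .and φ ψ => max (varBound φ) (varBound ψ)
  | .or φ ψ => max (varBound φ) (varBound ψ)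
  | .gdisj φ ψ => max (varBound φ) (varBound ψ)
  | .cneg φ => varBound φ
  | .ex v φ => max (v + 1) (varBound φ)
  | .al v φ => max (v + 1) (varBound φ)

/-- The first-order formula `x₀ = y₀ ∧ … ∧ xₖ₋₁ = yₖ₋₁`. -/
def tupleEq : (k : ℕ) → (Fin k → ℕ) → (Fin k → ℕ) → TS S ι ar
  | 0, _, _ => .top
  | k + 1, x, y => .and (.eq (x 0) (y 0)) (tupleEq k (x ∘ Fin.succ) (y ∘ Fin.succ))

theorem FSat_tupleEq (I : Interp S M) (s : ℕ → M) (k : ℕ) (x y : Fin k → ℕ) :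
    FSat M I s (tupleEq k x y : TS S ι ar) ↔ ∀ j, s (x j) = s (y j) := by
  induction k with
  | zero => simp [tupleEq, TS.top, FSat]
  | succ k ih => simp [tupleEq, FSat, ih, Fin.forall_fin_succ]

/-- Read the new relation symbols of `tupleSig S` as equality with a tuple of variables
beyond `b`. -/
def elimTuples (b : ℕ) : FOF (tupleSig S) → FOF S
  | .rel (.inl r) v => .rel r v
  | .rel (k := k) (.inr n) v => tupleEq k v fun j => b + Nat.pair n j
  | .nrel (.inl r) v => .nrel r v
  | .nrel (k := k) (.inr n) v => .cneg (tupleEq k v fun j => b + Nat.pair n j)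
  | .eq x y => .eq x y
  | .neq x y => .neq x y
  | .dep i _ => i.elim
  | .and φ ψ => .and (elimTuples b φ) (elimTuples b ψ)
  | .or φ ψ => .or (elimTuples b φ) (elimTuples b ψ)
  | .gdisj φ ψ => .gdisj (elimTuples b φ) (elimTuples b ψ)
  | .cneg φ => .cneg (elimTuples b φ)
  | .ex v φ => .ex v (elimTuples b φ)
  | .al v φ => .al v (elimTuples b φ)

theorem FSat_elimTuples (I : Interp S M) (J : ℕ → M) (b : ℕ) (φ : FOF (tupleSig S))
    (hb : varBound φ ≤ b) {s : ℕ → M} (hs : ∀ m, s (b + m) = J m) :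
    FSat M I s (elimTuples b φ) ↔ FSat M (tupleInterp I J) s φ := by
  have hupd {x : ℕ} (hx : x + 1 ≤ b) {s : ℕ → M} (hs : ∀ m, s (b + m) = J m) (a : M) (m : ℕ) :
      Function.update s x a (b + m) = J m := by
    rw [Function.update_of_ne (by omega), hs]
  induction φ generalizing s with
  | rel r v =>
    cases r with
    | inl r => rfl
    | inr n =>
      simp only [elimTuples, FSat_tupleEq, hs, FSat]
      exact funext_iff.symm
  | nrel r v =>
    cases r with
    | inl r => rfl
    | inr n =>
      simp only [elimTuples, FSat_tupleEq, hs, FSat]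
      exact not_congr funext_iff.symm
  | eq x y => rfl
  | neq x y => rfl
  | dep i v => exact i.elim
  | and φ ψ ih₁ ih₂ =>
    obtain ⟨h₁, h₂⟩ := max_le_iff.1 hb
    exact and_congr (ih₁ h₁ hs) (ih₂ h₂ hs)
  | or φ ψ ih₁ ih₂ =>
    obtain ⟨h₁, h₂⟩ := max_le_iff.1 hb
    exact or_congr (ih₁ h₁ hs) (ih₂ h₂ hs)
  | gdisj φ ψ ih₁ ih₂ =>
    obtain ⟨h₁, h₂⟩ := max_le_iff.1 hb
    exact or_congr (ih₁ h₁ hs) (ih₂ h₂ hs)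
  | cneg φ ih => exact not_congr (ih hb hs)
  | ex x φ ih =>
    obtain ⟨h₁, h₂⟩ := max_le_iff.1 hb
    exact exists_congr fun a => ih h₂ (hupd h₁ hs a)
  | al x φ ih =>
    obtain ⟨h₁, h₂⟩ := max_le_iff.1 hb
    exact forall_congr' fun a => ih h₂ (hupd h₁ hs a)

/-- First-order sentences over `S` are closed under existentially quantifying the parameters
named by the new symbols of `tupleSig S`. -/
theorem exists_sentence_iff_exists_tupleInterp {φ : FOF (tupleSig S)} (hφ : IsSentence φ) :
    ∃ ψ : FOF S, IsSentence ψ ∧ ∀ (M : Type), Nonempty M → ∀ I : Interp S M,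
      (FOTrue M I ψ ↔ ∃ J, FOTrue M (tupleInterp I J) φ) := by
  obtain ⟨ψ, hψ, h⟩ := exists_sentence_iff_exists_FSat (elimTuples (varBound φ) φ)
  refine ⟨ψ, hψ, fun M hM I => (h M hM I).trans ⟨fun ⟨s, hs⟩ => ?_, fun ⟨J, hJ⟩ => ?_⟩⟩
  · exact ⟨fun m => s (varBound φ + m), (FOTrue_iff_FSat _ hφ s).2
      ((FSat_elimTuples I _ _ φ le_rfl fun _ => rfl).1 hs)⟩
  · exact ⟨fun v => J (v - varBound φ),
      (FSat_elimTuples I J _ φ le_rfl fun m => by simp).2 (hJ _)⟩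

end ConstElimination

/-- If `𝒟` is a strongly first order, relativizable family, then
every sentence of `FO(𝒟, const)` is equivalent to some first-order sentence,
and every sentence of `FO(𝒟^(P), const)` is equivalent to some first-order
sentence. -/
theorem const_safe_for_sfo {ι : Type} {ar : ι → ℕ} (D : ∀ i, DepPred (ar i))
    (hiso : ∀ i, IsoClosed (D i)) (hsfo : SFOFam D) (hrel : RelativizableFam D) :
    (∀ (S : Signature) (φ : TS S (ι ⊕ ℕ) (Sum.elim ar id)), IsSentence φ → Plain φ →
      ∃ ψ : FOF S, IsSentence ψ ∧
        ∀ (M : Type), Nontrivial M → ∀ I : Interp S M,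
          (TTrue M I (fun i => withConst D i M) φ ↔ FOTrue M I ψ)) ∧
    (∀ (S : Signature) (P : S 1) (φ : TS S (ι ⊕ ℕ) (Sum.elim ar id)),
        IsSentence φ → Plain φ →
      ∃ ψ : FOF S, IsSentence ψ ∧
        ∀ (M : Type), Nontrivial M → ∀ I : Interp S M,
          (TTrue M I (withConstRel D P M I) φ ↔ FOTrue M I ψ)) := by
  constructor
  · intro S φ hs hp
    obtain ⟨χ, hχ, h⟩ := hsfo (tupleSig S) (elimConst φ 0)
      ((fv_elimConst φ 0).trans hs) (plain_elimConst hp 0)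
    obtain ⟨ψ, hψ, h'⟩ := exists_sentence_iff_exists_tupleInterp hχ
    refine ⟨ψ, hψ, fun M hM I => ?_⟩
    rw [h' M inferInstance I, TTrue, TSat_iff_exists_TSat_elimConst I (fun i => D i M) _
      (fun _ _ => Iff.rfl) (fun _ _ => Iff.rfl) hp 0]
    exact exists_congr fun J => h M hM (tupleInterp I J)
  · intro S P φ hs hp
    obtain ⟨θ, hθ, hθp, h₀⟩ := hrel (tupleSig S) (Sum.inl P : tupleSig S 1) (elimConst φ 0)
      ((fv_elimConst φ 0).trans hs) (plain_elimConst hp 0)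
    obtain ⟨χ, hχ, h⟩ := hsfo (tupleSig S) θ hθ hθp
    obtain ⟨ψ, hψ, h'⟩ := exists_sentence_iff_exists_tupleInterp hχ
    refine ⟨ψ, hψ, fun M hM I => ?_⟩
    rw [h' M inferInstance I, TTrue, TSat_iff_exists_TSat_elimConst I
      (fun i => relSem (D i) P M I) _ (fun _ _ => Iff.rfl) (fun _ _ => Iff.rfl) hp 0]
    exact exists_congr fun J =>
      (h₀ M hM (tupleInterp I J)).trans (h M hM (tupleInterp I J))

end DSFO
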